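/- arXiv:1309.1411 — 9 statements merged into one kernel-verified Lean document; each statement's English description precedes it below -/
import Mathlib

section
/- Let k, ℓ be coprime positive integers and u, v the unique positive integers with ku − ℓv = 1, u ≤ ℓ, v ≤ k. For every nonnegative integer m, the number e_m of pairs (i,j) of nonnegative integers with ki + ℓj = m equals ⌊mu/ℓ⌋ − ⌈mv/k⌉ + 1 (equivalently, e_m = [mu/ℓ[ − ]mv/k], where [x[ denotes the floor of x and ]x] denotes the strict integer part of x, i.e. the unique integer with ]x] < x ≤ ]x] + 1, so ]x] = ⌈x⌉ − 1). -/
/-- `eCount k l m` is the number of pairs `(i,j)` of nonnegative integers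
with `k*i + l*j = m`. -/
noncomputable def eCount (k l m : ℕ) : ℕ :=
  Nat.card {p : ℕ × ℕ // k * p.1 + l * p.2 = m}

theorem ceil_natCast_div_le_iff {n d : ℕ} (hd : 0 < d) (t : ℤ) :
    ⌈(n : ℚ) / d⌉ ≤ t ↔ (n : ℤ) ≤ d * t := by
  rw [Int.ceil_le, div_le_iff₀ (by exact_mod_cast hd), mul_comm]
  exact_mod_cast Iff.rfl

theorem le_floor_natCast_div_iff {n d : ℕ} (hd : 0 < d) (t : ℤ) :
    t ≤ ⌊(n : ℚ) / d⌋ ↔ d * t ≤ (n : ℤ) := by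
  rw [Int.le_floor, le_div_iff₀ (by exact_mod_cast hd), mul_comm]
  exact_mod_cast Iff.rfl

/-- The solutions of `k * i + l * j = m` are parametrized by the integers `t = u * j + v * i`
with `m * v ≤ k * t` and `l * t ≤ m * u`. -/
def solutionEquiv {k l u v : ℕ} (huv : k * u = l * v + 1) (m : ℕ) :
    {p : ℕ × ℕ // k * p.1 + l * p.2 = m} ≃
      {t : ℤ // ((m * v : ℕ) : ℤ) ≤ k * t ∧ l * t ≤ ((m * u : ℕ) : ℤ)} where
  toFun p := ⟨u * p.1.2 + v * p.1.1, by
    obtain ⟨⟨i, j⟩, h⟩ := p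
    zify at h huv
    push_cast
    constructor
    · linear_combination -(v : ℤ) * h - j * huv + Int.natCast_nonneg j
    · linear_combination (u : ℤ) * h - i * huv + Int.natCast_nonneg i⟩
  invFun t := ⟨((m * u - l * t.1).toNat, (k * t.1 - m * v).toNat), by
    obtain ⟨t, h₁, h₂⟩ := t
    push_cast at h₁ h₂
    zify at huv ⊢
    rw [Int.toNat_of_nonneg (by linarith), Int.toNat_of_nonneg (by linarith)]
    linear_combination (m : ℤ) * huv⟩
  left_inv := by
    rintro ⟨⟨i, j⟩, h⟩
    zify at h huv
    have hi : (m * u - l * (u * j + v * i) : ℤ) = i := by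
      linear_combination -(u : ℤ) * h + i * huv
    have hj : (k * (u * j + v * i) - m * v : ℤ) = j := by
      linear_combination (v : ℤ) * h + j * huv
    simp [hi, hj]
  right_inv := by
    rintro ⟨t, h₁, h₂⟩
    push_cast at h₁ h₂
    zify at huv
    ext
    dsimp only
    rw [Int.toNat_of_nonneg (by linarith), Int.toNat_of_nonneg (by linarith)]
    linear_combination t * huv

/-- if `k, l` are coprime positive integers and `u, v` are the
(unique) positive integers with `k*u - l*v = 1`, `u ≤ l`, `v ≤ k`, then for
every nonnegative integer `m`, the number `e_m` of pairs `(i,j) ∈ ℕ²` with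
`k*i + l*j = m` equals `⌊m*u/l⌋ - ⌈m*v/k⌉ + 1`. -/
theorem eCount_eq_floor_sub_ceil (k l u v : ℕ) (hk : 0 < k) (hl : 0 < l)
    (hkl : Nat.Coprime k l) (hu : 0 < u) (hv : 0 < v)
    (huv : k * u = l * v + 1) (hul : u ≤ l) (hvk : v ≤ k) :
    ∀ m : ℕ,
      (eCount k l m : ℤ) =
        ⌊(m * u : ℚ) / l⌋ - ⌈(m * v : ℚ) / k⌉ + 1 := by
  intro m
  have hle : (m * v : ℚ) / k ≤ m * u / l := by
    rw [div_le_div_iff₀ (by exact_mod_cast hk) (by exact_mod_cast hl)]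
    norm_cast
    calc m * v * l = m * (l * v) := by ring
      _ ≤ m * (k * u) := Nat.mul_le_mul_left m (by lia)
      _ = m * u * k := by ring
  have hceil : ⌈(m * v : ℚ) / k⌉ ≤ ⌊(m * u : ℚ) / l⌋ + 1 :=
    (Int.ceil_mono hle).trans (Int.ceil_le_floor_add_one _)
  have hcard : eCount k l m =
      (Finset.Icc ⌈(m * v : ℚ) / k⌉ ⌊(m * u : ℚ) / l⌋).card := by
    rw [eCount, Nat.card_congr (solutionEquiv huv m), ← Nat.card_eq_finsetCard]
    refine Nat.card_congr (Equiv.subtypeEquivRight fun t => ?_)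
    rw [Finset.mem_Icc, ← ceil_natCast_div_le_iff hk, ← le_floor_natCast_div_iff hl]
    push_cast
    rfl
  rw [hcard, Int.card_Icc, Int.toNat_of_nonneg (by lia)]
  ring
end

section
/- Let k, ℓ be coprime positive integers, u, v the unique positive integers with ku − ℓv = 1, u ≤ ℓ, v ≤ k, n ≥ 1 an integer, d = kℓn + k + ℓ. Fix nonzero complex numbers c₀, c₁, …, c_n with c₁, …, c_n pairwise distinct, and complex numbers λ₀, λ₁, …, λ_n, λ_∞, none of which is a rational number, satisfying λ₁ + ⋯ + λ_n + λ₀ + λ_∞ = −1. Let q_d = c₀xy∏_{i=1}^n(y^k − c_ix^ℓ), a_{d−k} = (q_d/x)(∑_{i=1}^n ℓλ_i c_i x^ℓ/(y^k − c_ix^ℓ) + u − ℓ(λ₀+1)), b_{d−ℓ} = −(q_d/y)(∑_{i=1}^n kλ_i y^k/(y^k − c_ix^ℓ) + v + kλ_∞). Then for every integer m ≥ 1, the polynomials A = m·a_{d−k} + ∂_x q_d and B = m·b_{d−ℓ} + ∂_y q_d are coprime in ℂ[x,y]. -/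
open MvPolynomial Finset

/-- Logarithmic derivation of a product: if `x * pderiv a (f i) = g i` for
every factor, then `x * pderiv a` of the product is the corresponding Leibniz sum. -/
lemma mul_pderiv_prod {σ ι R : Type*} [CommRing R] [DecidableEq ι] (s : Finset ι) (a : σ)
    (x : MvPolynomial σ R) (f g : ι → MvPolynomial σ R)
    (h : ∀ i ∈ s, x * pderiv a (f i) = g i) :
    x * pderiv a (∏ i ∈ s, f i) = ∑ i ∈ s, g i * ∏ j ∈ s.erase i, f j := by
  induction s using Finset.induction_on with
  | empty => simp
  | insert b s hb ih =>
    have hs : ∑ i ∈ s, g i * ∏ j ∈ (insert b s).erase i, f j =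
        f b * ∑ i ∈ s, g i * ∏ j ∈ s.erase i, f j := by
      rw [mul_sum]
      refine sum_congr rfl fun i hi => ?_
      have hbi : b ≠ i := fun e => hb (e ▸ hi)
      rw [erase_insert_of_ne hbi, prod_insert fun e => hb (mem_of_mem_erase e)]
      ring
    rw [sum_insert hb, erase_insert hb, hs, ← ih fun i hi => h i (mem_insert_of_mem hi),
      ← h b (mem_insert_self b s), prod_insert hb, pderiv_mul]
    ring

lemma X_mul_pderiv_left_sub {σ R : Type*} [CommRing R] {a b : σ} (hab : a ≠ b) (k l : ℕ)
    (hl : 0 < l) (c : R) :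
    (X a : MvPolynomial σ R) * pderiv a (X b ^ k - C c * X a ^ l) =
      -(C (l * c) * X a ^ l) := by
  obtain ⟨l, rfl⟩ := Nat.exists_eq_succ_of_ne_zero hl.ne'
  simp [pderiv_X_of_ne hab.symm]
  ring

lemma X_mul_pderiv_right_sub {σ R : Type*} [CommRing R] {a b : σ} (hab : a ≠ b) (k l : ℕ)
    (hk : 0 < k) (c : R) :
    (X b : MvPolynomial σ R) * pderiv b (X b ^ k - C c * X a ^ l) =
      C (k : R) * X b ^ k := by
  obtain ⟨k, rfl⟩ := Nat.exists_eq_succ_of_ne_zero hk.ne'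
  simp [pderiv_X_of_ne hab]
  ring

lemma not_prime_dvd_C {σ K : Type*} [Field K] {z : MvPolynomial σ K} (hz : Prime z) {c : K}
    (hc : c ≠ 0) : ¬ z ∣ C c := fun h =>
  hz.not_isUnit (isUnit_of_dvd_unit h ((isUnit_iff_ne_zero.mpr hc).map C))

lemma not_prime_dvd_X_and_X {σ K : Type*} [Field K] {a b : σ} (hab : a ≠ b)
    {z : MvPolynomial σ K} (hz : Prime z) (h0 : z ∣ X a) (h1 : z ∣ X b) : False := by
  have hX (i : σ) : Irreducible (X i : MvPolynomial σ K) := X_prime.irreducible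
  have hd : (X a : MvPolynomial σ K) ∣ X b :=
    (hz.irreducible.dvd_symm (hX a) h0).trans h1
  exact hab (X_dvd_X.1 hd)

/-- Two quasi-homogeneous polynomials of the shape produced by a logarithmic vector field along
`x y ∏ᵢ (y^k - cᵢ x^l)` have no common factor, when none of the residues vanishes. -/
lemma isRelPrime_of_residues_ne_zero {σ K ι : Type*} [Field K] [Fintype ι] [DecidableEq ι]
    {a b : σ} (hab : a ≠ b) {k l : ℕ} (hk : 0 < k) (hl : 0 < l) (hlK : (l : K) ≠ 0)
    {c₀ : K} (hc₀ : c₀ ≠ 0) {c : ι → K} (hc : ∀ i, c i ≠ 0) (hcinj : Function.Injective c)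
    {r : ι → K} (hr : ∀ i, r i ≠ 0) {s t : K} (hs : s ≠ 0) (ht : t ≠ 0)
    (htotal : k * s + l * t - k * l * ∑ i, r i ≠ 0) :
    IsRelPrime
      (C c₀ * X b * ((∑ i, C (l * c i * r i) * X a ^ l *
          ∏ j ∈ univ.erase i, (X b ^ k - C (c j) * X a ^ l)) +
        C s * ∏ i, (X b ^ k - C (c i) * X a ^ l)) : MvPolynomial σ K)
      (C c₀ * X a * (-(∑ i, C (k * r i) * X b ^ k *
          ∏ j ∈ univ.erase i, (X b ^ k - C (c j) * X a ^ l)) +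
        C t * ∏ i, (X b ^ k - C (c i) * X a ^ l))) := by
  set p : ι → MvPolynomial σ K := fun i => X b ^ k - C (c i) * X a ^ l with hp
  set A : MvPolynomial σ K := C c₀ * X b * ((∑ i, C (l * c i * r i) * X a ^ l *
    ∏ j ∈ univ.erase i, p j) + C s * ∏ i, p i) with hA
  set B : MvPolynomial σ K := C c₀ * X a * (-(∑ i, C (k * r i) * X b ^ k *
    ∏ j ∈ univ.erase i, p j) + C t * ∏ i, p i) with hB
  have euler : C (k : K) * X a * A + C (l : K) * X b * B =
      C (c₀ * (k * s + l * t - k * l * ∑ i, r i)) * X a * X b * ∏ i, p i := by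
    have hsum : C (k : K) * (∑ i, C (l * c i * r i) * X a ^ l * ∏ j ∈ univ.erase i, p j) -
        C (l : K) * (∑ i, C (k * r i) * X b ^ k * ∏ j ∈ univ.erase i, p j) =
        -(C (k * l * ∑ i, r i) * ∏ i, p i) := by
      rw [mul_sum, mul_sum, ← sum_sub_distrib, mul_sum, map_sum, sum_mul, ← sum_neg_distrib]
      refine sum_congr rfl fun i _ => ?_
      rw [← mul_prod_erase univ p (mem_univ i)]
      simp only [hp, map_mul]
      ring
    simp only [hA, hB, map_mul, map_sub, map_add] at hsum ⊢
    linear_combination C c₀ * X a * X b * hsum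
  have dvd_X_right {z : MvPolynomial σ K} (hz : Prime z) {i : ι} (h : z ∣ p i)
      (h0 : z ∣ X a) : z ∣ X b := by
    refine hz.dvd_of_dvd_pow (n := k) ?_
    rw [← sub_add_cancel (X b ^ k) (C (c i) * X a ^ l)]
    exact dvd_add h ((dvd_pow h0 hl.ne').mul_left _)
  have dvd_X_left {z : MvPolynomial σ K} (hz : Prime z) {i : ι} (h : z ∣ p i)
      (h1 : z ∣ X b) : z ∣ X a := by
    have : z ∣ C (c i) * X a ^ l := by
      rw [← sub_sub_cancel (X b ^ k) (C (c i) * X a ^ l)]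
      exact dvd_sub (dvd_pow h1 hk.ne') h
    exact hz.dvd_of_dvd_pow ((hz.dvd_or_dvd this).resolve_left (not_prime_dvd_C hz (hc i)))
  have key (z : MvPolynomial σ K) (hz : Prime z) (hzA : z ∣ A) (hzB : z ∣ B) : False := by
    have not_both := not_prime_dvd_X_and_X hab hz
    have hq : z ∣ C (c₀ * (k * s + l * t - k * l * ∑ i, r i)) * X a * X b * ∏ i, p i :=
      euler ▸ dvd_add (hzA.mul_left _) (hzB.mul_left _)
    rcases hz.dvd_or_dvd hq with hq | hq
    · rcases hz.dvd_or_dvd hq with hq | h1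
      · have h0 := (hz.dvd_or_dvd hq).resolve_left
          (not_prime_dvd_C hz (mul_ne_zero hc₀ htotal))
        rcases hz.dvd_or_dvd hzA with h | h
        · exact not_both h0 ((hz.dvd_or_dvd h).resolve_left (not_prime_dvd_C hz hc₀))
        · rw [dvd_add_right (dvd_sum fun i _ =>
            ((dvd_pow h0 hl.ne').mul_left _).mul_right _)] at h
          obtain ⟨i, -, hi⟩ := (hz.dvd_finsetProd_iff _).1
            ((hz.dvd_or_dvd h).resolve_left (not_prime_dvd_C hz hs))
          exact not_both h0 (dvd_X_right hz hi h0)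
      · rcases hz.dvd_or_dvd hzB with h | h
        · exact not_both ((hz.dvd_or_dvd h).resolve_left (not_prime_dvd_C hz hc₀)) h1
        · rw [dvd_add_right (dvd_neg.2 (dvd_sum fun i _ =>
            ((dvd_pow h1 hk.ne').mul_left _).mul_right _))] at h
          obtain ⟨i, -, hi⟩ := (hz.dvd_finsetProd_iff _).1
            ((hz.dvd_or_dvd h).resolve_left (not_prime_dvd_C hz ht))
          exact not_both (dvd_X_left hz hi h1) h1
    · obtain ⟨i, -, hi⟩ := (hz.dvd_finsetProd_iff _).1 hq
      have h0 : ¬ z ∣ X a := fun h => not_both h (dvd_X_right hz hi h)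
      have h1 : ¬ z ∣ X b := fun h => not_both (dvd_X_left hz hi h) h
      have h := ((hz.dvd_or_dvd hzA).resolve_left fun h =>
        (hz.dvd_or_dvd h).elim (not_prime_dvd_C hz hc₀) h1)
      rw [dvd_add_left ((hi.trans (dvd_prod_of_mem p (mem_univ i))).mul_left _),
        ← add_sum_erase univ _ (mem_univ i), dvd_add_left (dvd_sum fun j hj =>
          (hi.trans (dvd_prod_of_mem p
            (mem_erase.2 ⟨(ne_of_mem_erase hj).symm, mem_univ i⟩))).mul_left _)] at h
      rcases hz.dvd_or_dvd h with h | h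
      · exact (hz.dvd_or_dvd h).elim
          (not_prime_dvd_C hz (mul_ne_zero (mul_ne_zero hlK (hc i)) (hr i)))
          fun h => h0 (hz.dvd_of_dvd_pow h)
      · obtain ⟨j, hj, hjz⟩ := (hz.dvd_finsetProd_iff _).1 h
        have hsub : z ∣ C (c i - c j) * X a ^ l := by
          have : p j - p i = C (c i - c j) * X a ^ l := by
            simp only [hp, map_sub]
            ring
          exact this ▸ dvd_sub hjz hi
        exact (hz.dvd_or_dvd hsub).elim
          (not_prime_dvd_C hz (sub_ne_zero.2 (hcinj.ne (ne_of_mem_erase hj).symm)))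
          fun h => h0 (hz.dvd_of_dvd_pow h)
  refine WfDvdMonoid.isRelPrime_of_no_irreducible_factors ?_
    fun z hz hzA hzB => key z hz.prime hzA hzB
  rintro ⟨h, h'⟩
  exact key (X a) X_prime (h ▸ dvd_zero _) (h' ▸ dvd_zero _)

/-- with `k, l` coprime positive integers, `u, v` the unique
positive integers with `k*u - l*v = 1`, `u ≤ l`, `v ≤ k`, `n ≥ 1`,
`d = k*l*n + k + l`, nonzero `c₀, c₁, …, c_n` with `c₁, …, c_n` pairwise
distinct, and `λ₀, λ₁, …, λ_n, λ_∞` non-rational complex numbers summing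
(together) to `-1`, let `q_d = c₀ x y ∏ᵢ (y^k - cᵢ x^l)`,
`a_{d-k} = (q_d/x)(∑ᵢ l λᵢ cᵢ x^l/(y^k - cᵢ x^l) + u - l(λ₀+1))` and
`b_{d-l} = -(q_d/y)(∑ᵢ k λᵢ y^k/(y^k - cᵢ x^l) + v + k λ_∞)`.  Then for every
`m ≥ 1` the polynomials `A = m a_{d-k} + ∂ₓ q_d` and `B = m b_{d-l} + ∂_y q_d`
are coprime in `ℂ[x,y]` (any common divisor is a unit). -/
theorem A_B_coprime (k l u v n : ℕ) (hk : 0 < k) (hl : 0 < l)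
    (hkl : Nat.Coprime k l) (hu : 0 < u) (hv : 0 < v)
    (huv : k * u = l * v + 1) (hul : u ≤ l) (hvk : v ≤ k) (hn : 1 ≤ n)
    (c₀ : ℂ) (hc₀ : c₀ ≠ 0) (c : Fin n → ℂ) (hc : ∀ i, c i ≠ 0)
    (hcinj : Function.Injective c)
    (lam₀ lamInf : ℂ) (lam : Fin n → ℂ)
    (hlam₀ : ∀ r : ℚ, lam₀ ≠ (r : ℂ)) (hlamInf : ∀ r : ℚ, lamInf ≠ (r : ℂ))
    (hlam : ∀ i, ∀ r : ℚ, lam i ≠ (r : ℂ))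
    (hsum : (∑ i, lam i) + lam₀ + lamInf = -1) :
    ∀ m : ℕ, 1 ≤ m →
      IsRelPrime
        (C (m : ℂ) *
            (C c₀ * X 1 *
              ((∑ i, C (l * lam i * c i) * X 0 ^ l *
                  ∏ j ∈ univ.erase i, (X 1 ^ k - C (c j) * X 0 ^ l)) +
                C ((u : ℂ) - l * (lam₀ + 1)) *
                  ∏ i, (X 1 ^ k - C (c i) * X 0 ^ l))) +
          pderiv 0 (C c₀ * X 0 * X 1 * ∏ i, (X 1 ^ k - C (c i) * X 0 ^ l)))
        (C (m : ℂ) *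
            (-(C c₀ * X 0) *
              ((∑ i, C (k * lam i) * X 1 ^ k *
                  ∏ j ∈ univ.erase i, (X 1 ^ k - C (c j) * X 0 ^ l)) +
                C ((v : ℂ) + k * lamInf) *
                  ∏ i, (X 1 ^ k - C (c i) * X 0 ^ l))) +
          pderiv 1 (C c₀ * X 0 * X 1 * ∏ i, (X 1 ^ k - C (c i) * X 0 ^ l))) := by
  intro m hm
  have hm0 : (m : ℂ) ≠ 0 := Nat.cast_ne_zero.2 (by omega)
  have hk0 : (k : ℂ) ≠ 0 := Nat.cast_ne_zero.2 hk.ne'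
  have hl0 : (l : ℂ) ≠ 0 := Nat.cast_ne_zero.2 hl.ne'
  have huvC : (k : ℂ) * u = l * v + 1 := by exact_mod_cast huv
  have hr (i : Fin n) : (m : ℂ) * lam i - 1 ≠ 0 := fun h => hlam i (1 / m) (by
    push_cast
    field_simp
    linear_combination h)
  have hs : (m : ℂ) * (u - l * (lam₀ + 1)) + 1 ≠ 0 := fun h =>
    hlam₀ ((m * (u - l) + 1) / (m * l)) (by
      push_cast
      field_simp
      linear_combination -h)
  have ht : 1 - (m : ℂ) * (v + k * lamInf) ≠ 0 := fun h =>
    hlamInf ((1 - m * v) / (m * k)) (by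
      push_cast
      field_simp
      linear_combination -h)
  have htotal : (k : ℂ) * (m * (u - l * (lam₀ + 1)) + 1) + l * (1 - m * (v + k * lamInf)) -
      k * l * ∑ i, (m * lam i - 1) ≠ 0 := by
    have h : (k : ℂ) * (m * (u - l * (lam₀ + 1)) + 1) + l * (1 - m * (v + k * lamInf)) -
        k * l * ∑ i, (m * lam i - 1) = ((m + k + l + k * l * n : ℕ) : ℂ) := by
      rw [sum_sub_distrib, ← mul_sum]
      simp only [sum_const, card_univ, Fintype.card_fin, nsmul_eq_mul]
      push_cast
      linear_combination (m : ℂ) * huvC - m * k * l * hsum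
    rw [h]
    exact Nat.cast_ne_zero.2 (by omega)
  convert isRelPrime_of_residues_ne_zero (zero_ne_one : (0 : ℕ) ≠ 1) hk hl hl0 hc₀
    hc hcinj hr hs ht htotal using 2
  · have hP := mul_pderiv_prod univ 0 (X 0) _ _ fun (i : Fin n) _ =>
      X_mul_pderiv_left_sub (zero_ne_one : (0 : ℕ) ≠ 1) k l hl (c i)
    have hS : ∑ i, C (l * c i * (m * lam i - 1)) * X 0 ^ l *
          ∏ j ∈ univ.erase i, (X 1 ^ k - C (c j) * X 0 ^ l : MvPolynomial ℕ ℂ) =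
        C (m : ℂ) * (∑ i, C (l * lam i * c i) * X 0 ^ l *
          ∏ j ∈ univ.erase i, (X 1 ^ k - C (c j) * X 0 ^ l)) +
        ∑ i, -(C (l * c i) * X 0 ^ l) *
          ∏ j ∈ univ.erase i, (X 1 ^ k - C (c j) * X 0 ^ l) := by
      rw [mul_sum, ← sum_add_distrib]
      refine sum_congr rfl fun i _ => ?_
      simp only [map_mul, map_sub, map_one]
      ring
    have hX : pderiv 0 (X 1 : MvPolynomial ℕ ℂ) = 0 := pderiv_X_of_ne (by decide)
    have hq : pderiv 0 (C c₀ * X 0 * X 1 * ∏ i, (X 1 ^ k - C (c i) * X 0 ^ l)) =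
        C c₀ * X 1 * (∏ i, (X 1 ^ k - C (c i) * X 0 ^ l) +
          X 0 * pderiv 0 (∏ i, (X 1 ^ k - C (c i) * X 0 ^ l))) := by
      simp only [pderiv_mul, pderiv_C, pderiv_X_self, hX]
      ring
    rw [hS, hq, hP]
    simp only [map_add, map_mul, map_one]
    ring
  · have hP := mul_pderiv_prod univ 1 (X 1) _ _ fun (i : Fin n) _ =>
      X_mul_pderiv_right_sub (zero_ne_one : (0 : ℕ) ≠ 1) k l hk (c i)
    have hS : ∑ i, C (k * (m * lam i - 1)) * X 1 ^ k *
          ∏ j ∈ univ.erase i, (X 1 ^ k - C (c j) * X 0 ^ l : MvPolynomial ℕ ℂ) =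
        C (m : ℂ) * (∑ i, C (k * lam i) * X 1 ^ k *
          ∏ j ∈ univ.erase i, (X 1 ^ k - C (c j) * X 0 ^ l)) -
        ∑ i, C (k : ℂ) * X 1 ^ k *
          ∏ j ∈ univ.erase i, (X 1 ^ k - C (c j) * X 0 ^ l) := by
      rw [mul_sum, ← sum_sub_distrib]
      refine sum_congr rfl fun i _ => ?_
      simp only [map_mul, map_sub, map_one]
      ring
    have hX : pderiv 1 (X 0 : MvPolynomial ℕ ℂ) = 0 := pderiv_X_of_ne (by decide)
    have hq : pderiv 1 (C c₀ * X 0 * X 1 * ∏ i, (X 1 ^ k - C (c i) * X 0 ^ l)) =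
        C c₀ * X 0 * (∏ i, (X 1 ^ k - C (c i) * X 0 ^ l) +
          X 1 * pderiv 1 (∏ i, (X 1 ^ k - C (c i) * X 0 ^ l))) := by
      simp only [pderiv_mul, pderiv_C, pderiv_X_self, hX]
      ring
    rw [hS, hq, hP]
    simp only [map_sub, map_mul, map_one]
    ring
end

section
/- Let k, ℓ be coprime positive integers and n ≥ 1 an integer. Let Ā, B̄ ∈ ℂ[x,y] be nonzero coprime (k,ℓ)-quasi-homogeneous polynomials of degree kℓn. Then for every integer m ≥ kℓn, the linear map Ψ_m : QP(m) × QP(m) → QP(kℓn + m) defined by Ψ_m(U, V) = Ā·U + B̄·V is surjective: for every q ∈ QP(kℓn + m) there exist U, V ∈ QP(m) with Ā·U + B̄·V = q. -/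
open MvPolynomial

namespace MvPolynomial

section WeightCount

variable {k l : ℕ}

lemma weight_fin_two (k l : ℕ) (d : Fin 2 →₀ ℕ) :
    Finsupp.weight ![k, l] d = k * d 0 + l * d 1 := by
  simp [Finsupp.weight_apply, Finsupp.sum_fintype, mul_comm]

lemma finite_setOf_weight_eq (hk : 0 < k) (hl : 0 < l) (N : ℕ) :
    {d : Fin 2 →₀ ℕ | Finsupp.weight ![k, l] d = N}.Finite :=
  Finsupp.finite_of_nat_weight_eq _ (by simp [Fin.forall_fin_two, hk.ne', hl.ne']) N

lemma setOf_weight_add_mul_eq_insert (hl : 0 < l) (hkl : k.Coprime l) (N : ℕ) :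
    ∃ e : Fin 2 →₀ ℕ, e 0 < l ∧
      {d : Fin 2 →₀ ℕ | Finsupp.weight ![k, l] d = N + k * l} =
        insert e ((· + Finsupp.single 0 l) ''
          {d : Fin 2 →₀ ℕ | Finsupp.weight ![k, l] d = N}) := by
  obtain ⟨i, hil, hi⟩ := Nat.exists_mul_mod_eq_of_coprime (N + k * l) hkl hl.ne'
  have hle : k * i ≤ N + k * l := (Nat.mul_le_mul_left k hil.le).trans (Nat.le_add_left _ _)
  obtain ⟨j, hj⟩ := (Nat.modEq_iff_dvd' hle).mp hi
  have hij : k * i + l * j = N + k * l := by omega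
  refine ⟨Finsupp.equivFunOnFinite.symm ![i, j], by simpa using hil, ?_⟩
  ext d
  simp only [Set.mem_ofPred_eq, Set.mem_insert_iff, Set.mem_image, weight_fin_two]
  constructor
  · intro hd
    rcases lt_or_ge (d 0) l with h | h
    · left
      have h0 : d 0 = i := by
        have hmod : k * d 0 ≡ k * i [MOD l] := by
          have := congrArg (· % l) (hd.trans hij.symm)
          simpa [Nat.ModEq] using this
        exact (Nat.ModEq.cancel_left_of_coprime hkl.symm hmod).eq_of_lt_of_lt h hil
      have h1 : d 1 = j := by
        subst h0
        exact Nat.eq_of_mul_eq_mul_left hl (by omega)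
      ext x
      fin_cases x <;> simp [h0, h1]
    · right
      have hle : Finsupp.single 0 l ≤ d := by simpa using h
      refine ⟨d - Finsupp.single 0 l, ?_, tsub_add_cancel_of_le hle⟩
      obtain ⟨c, hc⟩ := Nat.exists_eq_add_of_le h
      simp only [Finsupp.coe_tsub, Pi.sub_apply, Finsupp.single_eq_same, hc,
        Nat.add_sub_cancel_left, Finsupp.single_apply]
      rw [hc, mul_add] at hd
      simp
      omega
  · rintro (rfl | ⟨c, hc, rfl⟩)
    · simpa using hij
    · simp [mul_add, ← hc]
      ring

lemma ncard_setOf_weight_add_mul (hk : 0 < k) (hl : 0 < l) (hkl : k.Coprime l) (N : ℕ) :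
    {d : Fin 2 →₀ ℕ | Finsupp.weight ![k, l] d = N + k * l}.ncard =
      {d : Fin 2 →₀ ℕ | Finsupp.weight ![k, l] d = N}.ncard + 1 := by
  obtain ⟨e, hel, he⟩ := setOf_weight_add_mul_eq_insert hl hkl N
  rw [he, Set.ncard_insert_of_notMem _ ((finite_setOf_weight_eq hk hl N).image _),
    Set.ncard_image_of_injective _ (add_left_injective _)]
  rintro ⟨c, -, rfl⟩
  simp at hel

end WeightCount

section WeightedHomogeneous

variable {K σ : Type*} [Field K]

lemma finrank_weightedHomogeneousSubmodule (w : σ → ℕ) (N : ℕ) :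
    Module.finrank K (weightedHomogeneousSubmodule K w N) =
      {d : σ →₀ ℕ | Finsupp.weight w d = N}.ncard := by
  rw [weightedHomogeneousSubmodule_eq_finsupp_supported]
  exact Module.finrank_eq_nat_card_basis (basisRestrictSupport K {d | Finsupp.weight w d = N})

lemma finrank_weightedHomogeneousSubmodule_add_mul {k l : ℕ} (hk : 0 < k) (hl : 0 < l)
    (hkl : k.Coprime l) (N n : ℕ) :
    Module.finrank K (weightedHomogeneousSubmodule K ![k, l] (N + k * l * n)) =
      Module.finrank K (weightedHomogeneousSubmodule K ![k, l] N) + n := by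
  induction n with
  | zero => simp
  | succ n ih =>
    simp only [finrank_weightedHomogeneousSubmodule] at ih ⊢
    rw [Nat.mul_succ, ← add_assoc, ncard_setOf_weight_add_mul hk hl hkl, ih, add_assoc]

/-- The weighted homogeneous components of a product with a weighted homogeneous left factor. -/
lemma IsWeightedHomogeneous.component_mul {w : σ → ℕ} {A : MvPolynomial σ K} {D : ℕ}
    (hA : A.IsWeightedHomogeneous w D) (W : MvPolynomial σ K) (N : ℕ) :
    weightedHomogeneousComponent w (D + N) (A * W) =
      A * weightedHomogeneousComponent w N W := by
  let _ := weightedGradedAlgebra K w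
  have h := DirectSum.coe_decompose_mul_of_left_mem_of_le
    (weightedHomogeneousSubmodule K w) (a := A) (b := W) (n := D + N) hA (Nat.le_add_right _ _)
  rw [Nat.add_sub_cancel_left] at h
  simp only [← weightedDecomposition.decompose'_apply]
  exact h

/-- Multiplication by a weighted homogeneous polynomial, as a map between graded pieces. -/
noncomputable def weightedMulLeft {w : σ → ℕ} {A : MvPolynomial σ K} {D m M : ℕ}
    (hA : A.IsWeightedHomogeneous w D) (h : D + m = M) :
    weightedHomogeneousSubmodule K w m →ₗ[K] weightedHomogeneousSubmodule K w M :=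
  (LinearMap.mulLeft K A).restrict fun _ hU => h ▸ hA.mul hU

/-- The map `(U, V) ↦ A * U + B * V` between graded pieces. -/
noncomputable def weightedSyzygyMap {w : σ → ℕ} {A B : MvPolynomial σ K} {D : ℕ}
    (hA : A.IsWeightedHomogeneous w D) (hB : B.IsWeightedHomogeneous w D) (m : ℕ) :
    weightedHomogeneousSubmodule K w m × weightedHomogeneousSubmodule K w m →ₗ[K]
      weightedHomogeneousSubmodule K w (D + m) :=
  (weightedMulLeft hA rfl).coprod (weightedMulLeft hB rfl)

lemma ker_weightedSyzygyMap_le {w : σ → ℕ} {A B : MvPolynomial σ K} {D : ℕ}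
    (hA : A.IsWeightedHomogeneous w D) (hB : B.IsWeightedHomogeneous w D) (hA0 : A ≠ 0)
    (hcop : IsRelPrime A B) (m : ℕ) :
    LinearMap.ker (weightedSyzygyMap hA hB (D + m)) ≤
      LinearMap.range ((-weightedMulLeft hB rfl).prod (weightedMulLeft hA rfl) :
        weightedHomogeneousSubmodule K w m →ₗ[K] _) := by
  rintro ⟨⟨U, hU⟩, ⟨V, hV⟩⟩ h
  have hUV : A * U + B * V = 0 := congrArg Subtype.val (LinearMap.mem_ker.mp h)
  obtain ⟨W', rfl⟩ : A ∣ V := hcop.dvd_of_dvd_mul_left ⟨-U, by linear_combination hUV⟩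
  have hW : A * weightedHomogeneousComponent w m W' = A * W' := by
    rw [← hA.component_mul]
    exact weightedHomogeneousComponent_eq_self hV
  have hU' : -(B * weightedHomogeneousComponent w m W') = U := by
    apply mul_left_cancel₀ hA0
    linear_combination -hUV - B * hW
  exact ⟨⟨weightedHomogeneousComponent w m W', weightedHomogeneousComponent_mem w W' m⟩,
    Prod.ext (Subtype.ext hU') (Subtype.ext hW)⟩

lemma weightedSyzygyMap_surjective {k l n : ℕ} (hk : 0 < k) (hl : 0 < l) (hkl : k.Coprime l)
    {A B : MvPolynomial (Fin 2) K} (hA0 : A ≠ 0)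
    (hA : A.IsWeightedHomogeneous ![k, l] (k * l * n))
    (hB : B.IsWeightedHomogeneous ![k, l] (k * l * n)) (hcop : IsRelPrime A B) (m : ℕ) :
    Function.Surjective (weightedSyzygyMap hA hB (k * l * n + m)) := by
  have hfin (N : ℕ) : Module.Finite K (weightedHomogeneousSubmodule K ![k, l] N) :=
    Module.Finite.iff_fg.mpr (weightedHomogeneousSubmodule_fg K _
      (by simp [Fin.forall_fin_two, hk.ne', hl.ne']) N)
  have hker := (Submodule.finrank_mono (ker_weightedSyzygyMap_le hA hB hA0 hcop m)).trans
    (LinearMap.finrank_range_le _)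
  have hrank := (weightedSyzygyMap hA hB (k * l * n + m)).finrank_range_add_finrank_ker
  have h₁ := finrank_weightedHomogeneousSubmodule_add_mul (K := K) hk hl hkl m n
  have h₂ := finrank_weightedHomogeneousSubmodule_add_mul (K := K) hk hl hkl (m + k * l * n) n
  rw [add_comm] at h₁
  rw [add_comm, add_comm m] at h₂
  rw [Module.finrank_prod] at hrank
  rw [← LinearMap.range_eq_top]
  apply Submodule.eq_top_of_finrank_eq
  have hle := (LinearMap.range (weightedSyzygyMap hA hB (k * l * n + m))).finrank_le
  omega

end WeightedHomogeneous

end MvPolynomial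

/-- let `k, l` be coprime positive integers and `n ≥ 1`.  Let
`Ā, B̄ ∈ ℂ[x,y]` be nonzero coprime `(k,l)`-quasi-homogeneous polynomials of
degree `k*l*n`.  Then for every `m ≥ k*l*n`, every `(k,l)`-quasi-homogeneous
polynomial `q` of degree `k*l*n + m` can be written `q = Ā*U + B̄*V` with
`U, V` `(k,l)`-quasi-homogeneous of degree `m`. -/
theorem psi_surjective (k l n : ℕ) (hk : 0 < k) (hl : 0 < l)
    (hkl : Nat.Coprime k l) (hn : 1 ≤ n)
    (A B : MvPolynomial (Fin 2) ℂ) (hA : A ≠ 0) (hB : B ≠ 0)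
    (hAh : A.IsWeightedHomogeneous ![k, l] (k * l * n))
    (hBh : B.IsWeightedHomogeneous ![k, l] (k * l * n))
    (hcop : IsRelPrime A B) :
    ∀ m : ℕ, k * l * n ≤ m →
      ∀ q : MvPolynomial (Fin 2) ℂ,
        q.IsWeightedHomogeneous ![k, l] (k * l * n + m) →
        ∃ U V : MvPolynomial (Fin 2) ℂ,
          U.IsWeightedHomogeneous ![k, l] m ∧
          V.IsWeightedHomogeneous ![k, l] m ∧
          A * U + B * V = q := by
  intro m hm q hq
  obtain ⟨c, rfl⟩ := Nat.exists_eq_add_of_le hm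
  obtain ⟨⟨U, V⟩, hUV⟩ := weightedSyzygyMap_surjective hk hl hkl hA hAh hBh hcop c ⟨q, hq⟩
  exact ⟨U, V, U.2, V.2, congrArg Subtype.val hUV⟩
end

section
/- Let k, ℓ be coprime positive integers and n ≥ 1 an integer. Then for every integer m with 1 ≤ m ≤ kℓn − 1, the number of pairs (i,j) of nonnegative integers with ki + ℓj = kℓn + m and (i ≥ ℓn or j ≥ kn) equals 2·e_m, where e_m denotes the number of pairs (i,j) of nonnegative integers with ki + ℓj = m. -/
/-- A linear equation with positive coefficients has finitely many solutions in `ℕ × ℕ`. -/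
theorem finite_eCount_pairs {k l : ℕ} (hk : 0 < k) (hl : 0 < l) (m : ℕ) :
    Finite {p : ℕ × ℕ // k * p.1 + l * p.2 = m} := by
  refine Set.Finite.subset (Set.finite_Iic (m, m)) fun p hp => ?_
  have hp : k * p.1 + l * p.2 = m := hp
  have h₁ := Nat.le_mul_of_pos_left p.1 hk
  have h₂ := Nat.le_mul_of_pos_left p.2 hl
  exact ⟨by dsimp only; omega, by dsimp only; omega⟩

/-- If `k * a = l * b = N` and `m < N`, the solutions of `k * i + l * j = N + m` with `a ≤ i` or
`b ≤ j` are the disjoint union of two translates of the solutions of `k * i + l * j = m`. -/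
theorem card_translates_eq_two_eCount {k l a b N m : ℕ} (hk : 0 < k) (hl : 0 < l)
    (ha : k * a = N) (hb : l * b = N) (hm : m < N) :
    Nat.card {p : ℕ × ℕ // k * p.1 + l * p.2 = N + m ∧ (a ≤ p.1 ∨ b ≤ p.2)} =
      2 * eCount k l m := by
  have := finite_eCount_pairs hk hl m
  let S := {p : ℕ × ℕ // k * p.1 + l * p.2 = m}
  let T := {p : ℕ × ℕ // k * p.1 + l * p.2 = N + m ∧ (a ≤ p.1 ∨ b ≤ p.2)}
  let f : S ⊕ S → T := Sum.elim
    (fun p => ⟨(p.1.1 + a, p.1.2), by have := p.2; dsimp only; rw [mul_add]; omega,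
      Or.inl (Nat.le_add_left _ _)⟩)
    (fun p => ⟨(p.1.1, p.1.2 + b), by have := p.2; dsimp only; rw [mul_add]; omega,
      Or.inr (Nat.le_add_left _ _)⟩)
  have not_both {i j i' j' : ℕ} (h : k * i + l * j = m) (h' : k * i' + l * j' = m)
      (hi : i + a = i') : False := by
    subst hi
    rw [mul_add] at h'
    omega
  have hf : Function.Bijective f := by
    constructor
    · rintro (⟨⟨i, j⟩, h⟩ | ⟨⟨i, j⟩, h⟩) (⟨⟨i', j'⟩, h'⟩ | ⟨⟨i', j'⟩, h'⟩) e <;>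
        replace e := Prod.mk.inj (congrArg Subtype.val e)
      · obtain ⟨e₁, rfl⟩ := e
        obtain rfl := Nat.add_right_cancel e₁
        rfl
      · exact (not_both h h' e.1).elim
      · exact (not_both h' h e.1.symm).elim
      · obtain ⟨rfl, e₂⟩ := e
        obtain rfl := Nat.add_right_cancel e₂
        rfl
    · rintro ⟨⟨i, j⟩, h, hi | hj⟩
      · obtain ⟨c, rfl⟩ := Nat.exists_eq_add_of_le' hi
        exact ⟨Sum.inl ⟨(c, j), by dsimp only at h ⊢; rw [mul_add] at h; omega⟩, rfl⟩
      · obtain ⟨c, rfl⟩ := Nat.exists_eq_add_of_le' hj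
        exact ⟨Sum.inr ⟨(i, c), by dsimp only at h ⊢; rw [mul_add] at h; omega⟩, rfl⟩
  calc Nat.card T = Nat.card (S ⊕ S) := (Nat.card_eq_of_bijective f hf).symm
    _ = Nat.card S + Nat.card S := Nat.card_sum
    _ = 2 * eCount k l m := (two_mul _).symm

/-- for coprime positive integers `k, l` and `n ≥ 1`, for every
`1 ≤ m ≤ k*l*n - 1`, the number of pairs `(i,j) ∈ ℕ²` with
`k*i + l*j = k*l*n + m` and (`i ≥ l*n` or `j ≥ k*n`) equals `2 * e_m`. -/
theorem card_perp_eq_two_eCount (k l n : ℕ) (hk : 0 < k) (hl : 0 < l)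
    (hkl : Nat.Coprime k l) (hn : 1 ≤ n) :
    ∀ m : ℕ, 1 ≤ m → m ≤ k * l * n - 1 →
      Nat.card {p : ℕ × ℕ //
          k * p.1 + l * p.2 = k * l * n + m ∧ (l * n ≤ p.1 ∨ k * n ≤ p.2)} =
        2 * eCount k l m := by
  intro m _ hm
  have hN : 0 < k * l * n := by positivity
  exact card_translates_eq_two_eCount hk hl (by ring) (by ring) (by omega)
end

section
/- Let k, ℓ be coprime positive integers, n ≥ 1 an integer, and m an integer with 1 ≤ m ≤ kℓn − 1; set e = e_m, the number of pairs (i,j) of nonnegative integers with ki + ℓj = m. Over the polynomial ring ℤ[A₀, …, A_n, B₀, …, B_n] in 2n + 2 indeterminates, define the 2e × 2e matrix M_m by: for 1 ≤ r, q ≤ e, the (r, q) entry is A_{r−q}, the (r, e+q) entry is B_{n−r+q}, the (e+r, q) entry is A_{n−q+r}, and the (e+r, e+q) entry is B_{q−r}, with the convention A_t = B_t = 0 whenever t < 0 or t > n. Then the coefficient of the monomial A₀^e·B₀^e in det M_m equals 1; in particular det M_m is not the zero polynomial (equivalently, ∂^{2e}(det M_m)/(∂A₀^e ∂B₀^e)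 = (e!)²). -/
open MvPolynomial

/-- The indeterminate `A_t` of `ℤ[A₀,…,A_n,B₀,…,B_n]`, with the convention
`A_t = 0` for `t < 0` or `t > n`. -/
noncomputable def Aext (n : ℕ) (t : ℤ) :
    MvPolynomial (Fin (n + 1) ⊕ Fin (n + 1)) ℤ :=
  if h : 0 ≤ t ∧ t ≤ n then X (Sum.inl ⟨t.toNat, by omega⟩) else 0

/-- The indeterminate `B_t` of `ℤ[A₀,…,A_n,B₀,…,B_n]`, with the convention
`B_t = 0` for `t < 0` or `t > n`. -/
noncomputable def Bext (n : ℕ) (t : ℤ) :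
    MvPolynomial (Fin (n + 1) ⊕ Fin (n + 1)) ℤ :=
  if h : 0 ≤ t ∧ t ≤ n then X (Sum.inr ⟨t.toNat, by omega⟩) else 0

/-- The `2e × 2e` matrix `M_m` of the paper: in 1-based notation, for
`1 ≤ r, q ≤ e`, the `(r,q)` entry is `A_{r-q}`, the `(r, e+q)` entry is
`B_{n-r+q}`, the `(e+r, q)` entry is `A_{n-q+r}`, and the `(e+r, e+q)` entry
is `B_{q-r}`. -/
noncomputable def Mmat (n e : ℕ) :
    Matrix (Fin e ⊕ Fin e) (Fin e ⊕ Fin e)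
      (MvPolynomial (Fin (n + 1) ⊕ Fin (n + 1)) ℤ) :=
  Matrix.fromBlocks
    (fun r q => Aext n ((r : ℤ) - (q : ℤ)))
    (fun r q => Bext n ((n : ℤ) - (r : ℤ) + (q : ℤ)))
    (fun r q => Aext n ((n : ℤ) - (q : ℤ) + (r : ℤ)))
    (fun r q => Bext n ((q : ℤ) - (r : ℤ)))

/-- Setting to zero the variables outside `S` does not change the coefficient of a monomial
supported on `S`. -/
theorem MvPolynomial.coeff_aeval_ite_of_support_subset {σ R : Type*} [CommRing R] (S : σ → Prop)
    [DecidablePred S] (d : σ →₀ ℕ) (hd : ∀ v, d v ≠ 0 → S v) (p : MvPolynomial σ R) :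
    coeff d (aeval (fun v => if S v then (X v : MvPolynomial σ R) else 0) p) = coeff d p := by
  classical
  induction p using MvPolynomial.induction_on' with
  | add p q hp hq => rw [map_add, coeff_add, coeff_add, hp, hq]
  | monomial u a =>
    by_cases hu : ∀ v, u v ≠ 0 → S v
    · congr 1
      rw [aeval_monomial, monomial_eq, algebraMap_eq]
      congr 1
      refine Finsupp.prod_congr fun v hv => ?_
      rw [if_pos (hu v (Finsupp.mem_support_iff.mp hv))]
    · push Not at hu
      obtain ⟨v, hv, hS⟩ := hu
      have hne : u ≠ d := by
        rintro rfl
        exact hS (hd v hv)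
      rw [aeval_monomial, coeff_monomial, if_neg hne, Finsupp.prod,
        Finset.prod_eq_zero (Finsupp.mem_support_iff.mpr hv) (by simp [hS, hv]), mul_zero,
        coeff_zero]

theorem eCount_le {k l n m : ℕ} (hl : 0 < l) (hkl : Nat.Coprime k l)
    (hm : m < k * l * n) : eCount k l m ≤ n := by
  have key : ∀ p : {p : ℕ × ℕ // k * p.1 + l * p.2 = m}, p.1.1 / l < n := by
    rintro ⟨⟨i, j⟩, h⟩
    rw [Nat.div_lt_iff_lt_mul hl]
    refine Nat.lt_of_mul_lt_mul_left (a := k) ?_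
    calc k * i ≤ m := by simp only at h; omega
      _ < k * l * n := hm
      _ = k * (n * l) := by ring
  have hinj : Function.Injective
      (fun p : {p : ℕ × ℕ // k * p.1 + l * p.2 = m} => (⟨p.1.1 / l, key p⟩ : Fin n)) := by
    rintro ⟨⟨i, j⟩, h⟩ ⟨⟨i', j'⟩, h'⟩ heq
    simp only [Fin.mk.injEq] at heq h h'
    have hmod : i ≡ i' [MOD l] := by
      refine Nat.ModEq.cancel_left_of_coprime (c := k) (hkl.symm) ?_
      have h1 : k * i + l * j ≡ k * i' + l * j' [MOD l] := by rw [h, h']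
      simpa [Nat.ModEq] using h1
    have hi : i = i' := by
      rw [← Nat.div_add_mod i l, ← Nat.div_add_mod i' l, heq, hmod]
    subst hi
    have hj : j = j' := Nat.eq_of_mul_eq_mul_left hl (by omega)
    rw [Subtype.mk.injEq, hj]
  simpa [eCount] using Nat.card_le_card_of_injective _ hinj

/-- If `e ≤ n`, setting all variables except `A₀` and `B₀` to zero makes `Mmat n e` diagonal. -/
theorem Mmat_map_aeval {n e : ℕ} (hen : e ≤ n) :
    (Mmat n e).map (aeval (R := ℤ) fun v : Fin (n + 1) ⊕ Fin (n + 1) =>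
        if v = Sum.inl 0 ∨ v = Sum.inr 0 then (X v : MvPolynomial _ ℤ) else 0) =
      Matrix.diagonal (Sum.elim (fun _ : Fin e => X (Sum.inl 0)) fun _ : Fin e => X (Sum.inr 0)) :=
    by
  have hA (t : ℤ) : aeval (R := ℤ) (fun v : Fin (n + 1) ⊕ Fin (n + 1) =>
      if v = Sum.inl 0 ∨ v = Sum.inr 0 then (X v : MvPolynomial _ ℤ) else 0) (Aext n t) =
      if t = 0 then X (Sum.inl 0) else 0 := by
    unfold Aext
    split_ifs with h h0 h0
    · subst h0; simp
    · have : ¬ t ≤ 0 := by omega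
      simp [Fin.ext_iff, this]
    · omega
    · simp
  have hB (t : ℤ) : aeval (R := ℤ) (fun v : Fin (n + 1) ⊕ Fin (n + 1) =>
      if v = Sum.inl 0 ∨ v = Sum.inr 0 then (X v : MvPolynomial _ ℤ) else 0) (Bext n t) =
      if t = 0 then X (Sum.inr 0) else 0 := by
    unfold Bext
    split_ifs with h h0 h0
    · subst h0; simp
    · have : ¬ t ≤ 0 := by omega
      simp [Fin.ext_iff, this]
    · omega
    · simp
  ext1 a b
  rcases a with r | r <;> rcases b with q | q
  · refine (hA _).trans ?_
    simp only [Matrix.diagonal_apply, Sum.inl.injEq, Sum.elim_inl, Fin.ext_iff]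
    exact if_congr (by omega) rfl rfl
  · refine (hB _).trans ?_
    rw [Matrix.diagonal_apply_ne _ Sum.inl_ne_inr, if_neg (by omega)]
  · refine (hA _).trans ?_
    rw [Matrix.diagonal_apply_ne _ Sum.inr_ne_inl, if_neg (by omega)]
  · refine (hB _).trans ?_
    simp only [Matrix.diagonal_apply, Sum.inr.injEq, Sum.elim_inr, Fin.ext_iff]
    exact if_congr (by omega) rfl rfl

/-- with `k, l` coprime positive integers, `n ≥ 1`,
`1 ≤ m ≤ k*l*n - 1` and `e = e_m`, the coefficient of the monomial
`A₀^e · B₀^e` in `det M_m` equals `1`; in particular `det M_m ≠ 0`. -/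
theorem det_Mm_ne_zero (k l n m e : ℕ) (hk : 0 < k) (hl : 0 < l)
    (hkl : Nat.Coprime k l) (hn : 1 ≤ n)
    (hm1 : 1 ≤ m) (hm2 : m ≤ k * l * n - 1) (he : e = eCount k l m) :
    MvPolynomial.coeff
        (Finsupp.single (Sum.inl (0 : Fin (n + 1))) e +
          Finsupp.single (Sum.inr (0 : Fin (n + 1))) e)
        (Mmat n e).det = 1 ∧
      (Mmat n e).det ≠ 0 := by
  have hen : e ≤ n := by
    have hpos : 0 < k * l * n := by positivity
    exact he ▸ eCount_le hl hkl (by omega)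
  have hcoeff : MvPolynomial.coeff
      (Finsupp.single (Sum.inl (0 : Fin (n + 1))) e +
        Finsupp.single (Sum.inr (0 : Fin (n + 1))) e) (Mmat n e).det = 1 := by
    rw [← coeff_aeval_ite_of_support_subset (fun v => v = Sum.inl 0 ∨ v = Sum.inr 0),
      AlgHom.map_det, AlgHom.mapMatrix_apply, Mmat_map_aeval hen, Matrix.det_diagonal,
      Fintype.prod_sum_type]
    · simp [X_pow_eq_monomial, monomial_mul]
    · intro v hv
      by_contra! hne
      exact hv (by simp [hne.1.symm, hne.2.symm])
  refine ⟨hcoeff, fun h0 => ?_⟩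
  rw [h0, coeff_zero] at hcoeff
  exact zero_ne_one hcoeff
end

section
/- Let k, ℓ be coprime positive integers, d an integer, and m any integer. Let a, b ∈ ℂ[x,y] be (k,ℓ)-quasi-homogeneous polynomials of degrees d − k and d − ℓ respectively, and set q = kxa + ℓyb, A = m·a + ∂_x q, B = m·b + ∂_y q. Then a·B − b·A = q·(∂_y a − ∂_x b). -/
open MvPolynomial

/-- Euler's identity for quasi-homogeneous polynomials in two variables, of integer degree. -/
theorem euler_identity_of_quasiHomogeneous {R : Type*} [CommRing R] (k l : ℕ) (e : ℤ)
    (a : MvPolynomial (Fin 2) R)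
    (ha : ∀ p ∈ a.support, (k * p 0 + l * p 1 : ℤ) = e) :
    C (k : R) * (X 0 * pderiv 0 a) + C (l : R) * (X 1 * pderiv 1 a) = C (e : R) * a := by
  rw [a.as_sum]
  simp only [map_sum, Finset.mul_sum, ← Finset.sum_add_distrib]
  refine Finset.sum_congr rfl fun p hp => ?_
  simp only [X_mul_pderiv_monomial, ← ha p hp, nsmul_eq_mul]
  push_cast
  simp only [map_add, map_mul, map_natCast]
  ring

/-- let `k, l` be coprime positive integers, `d` an integer and
`m` any integer.  If `a, b ∈ ℂ[x,y]` are `(k,l)`-quasi-homogeneous of degrees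
`d - k` and `d - l` respectively (every monomial `x^i y^j` occurring in them
satisfies `k*i + l*j = d - k`, resp. `d - l`), and `q = k*x*a + l*y*b`,
`A = m*a + ∂ₓ q`, `B = m*b + ∂_y q`, then `a*B - b*A = q*(∂_y a - ∂ₓ b)`. -/
theorem radial_key_identity (k l : ℕ) (hk : 0 < k) (hl : 0 < l)
    (hkl : Nat.Coprime k l) (d m : ℤ)
    (a b : MvPolynomial (Fin 2) ℂ)
    (ha : ∀ p ∈ a.support, (k * p 0 + l * p 1 : ℤ) = d - k)
    (hb : ∀ p ∈ b.support, (k * p 0 + l * p 1 : ℤ) = d - l) :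
    a * ((C (m : ℂ)) * b + pderiv 1 ((C (k : ℂ)) * X 0 * a + (C (l : ℂ)) * X 1 * b)) -
      b * ((C (m : ℂ)) * a + pderiv 0 ((C (k : ℂ)) * X 0 * a + (C (l : ℂ)) * X 1 * b)) =
    ((C (k : ℂ)) * X 0 * a + (C (l : ℂ)) * X 1 * b) * (pderiv 1 a - pderiv 0 b) := by
  have euler_a := euler_identity_of_quasiHomogeneous k l (d - k) a ha
  have euler_b := euler_identity_of_quasiHomogeneous k l (d - l) b hb
  have h01 : pderiv 0 (X 1 : MvPolynomial (Fin 2) ℂ) = 0 := pderiv_X_of_ne (by decide)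
  have h10 : pderiv 1 (X 0 : MvPolynomial (Fin 2) ℂ) = 0 := pderiv_X_of_ne (by decide)
  push_cast at euler_a euler_b
  simp only [map_sub] at euler_a euler_b
  simp only [map_add, Derivation.leibniz, smul_eq_mul, pderiv_C, pderiv_X_self, h01, h10]
  linear_combination a * euler_b - b * euler_a
end

section
/- Let k, ℓ be coprime positive integers, u, v the unique positive integers with ku − ℓv = 1, u ≤ ℓ, v ≤ k, n ≥ 1 an integer, d = kℓn + k + ℓ. Fix nonzero complex numbers c₀, c₁, …, c_n with c₁, …, c_n pairwise distinct, and complex numbers λ₁, …, λ_n, λ_∞, none of which is a rational number. Let q_d = c₀xy∏_{i=1}^n(y^k − c_ix^ℓ) and b_{d−ℓ} = −(q_d/y)(∑_{i=1}^n kλ_i y^k/(y^k − c_ix^ℓ) + v + kλ_∞); then x divides b_{d−ℓ}, and we set b̄ = b_{d−ℓ}/x and q̄ = q_d/x, which are polynomials in ℂ[x,y]. Then for every integer m ≥ 1, the linear map Φ_m : QP(m) → QP(kℓn + m) defined by Φ_m(T) = m·b̄·T − q̄·∂_y T is injective. -/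
open MvPolynomial Finset

/-- A nonzero polynomial killed by `y F ∂_y - G` forces the constant term (in `y`) of `G` to be
a natural number multiple of that of `F`. -/
theorem exists_nat_X_dvd_of_mul_pderiv_eq {σ R : Type*} [CommRing R] [IsDomain R]
    [WfDvdMonoid (MvPolynomial σ R)] (i : σ) {F G T : MvPolynomial σ R} (hT : T ≠ 0)
    (h : X i * F * pderiv i T = G * T) :
    ∃ r : ℕ, X i ∣ (r : MvPolynomial σ R) * F - G := by
  have hX : Prime (X i : MvPolynomial σ R) := X_prime
  obtain ⟨r, S, hS, rfl⟩ := WfDvdMonoid.max_power_factor hT hX.irreducible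
  refine ⟨r, (hX.dvd_or_dvd (b := S) ?_).resolve_right hS⟩
  have hpow : X i * pderiv i ((X i : MvPolynomial σ R) ^ r) =
      (r : MvPolynomial σ R) * X i ^ r := by
    rw [pderiv_pow, pderiv_X_self]
    rcases r with _ | r
    · simp
    · rw [Nat.add_sub_cancel]; ring
  have hcancel : X i ^ r * (((r : MvPolynomial σ R) * F - G) * S)
      = X i ^ r * (X i * (-(F * pderiv i S))) := by
    rw [pderiv_mul] at h
    linear_combination h - F * S * hpow
  exact ⟨_, mul_left_cancel₀ (pow_ne_zero r hX.ne_zero) hcancel⟩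

/-- with `k, l` coprime positive integers, `u, v` the unique
positive integers with `k*u - l*v = 1`, `u ≤ l`, `v ≤ k`, `n ≥ 1`,
`d = k*l*n + k + l`, nonzero `c₀, c₁, …, c_n` with `c₁, …, c_n` pairwise
distinct, and non-rational `λ₁, …, λ_n, λ_∞`, set
`q_d = c₀ x y ∏ᵢ (y^k - cᵢ x^l)`,
`b_{d-l} = -(q_d/y)(∑ᵢ k λᵢ y^k/(y^k - cᵢ x^l) + v + k λ_∞)`,
`b̄ = b_{d-l}/x` and `q̄ = q_d/x`.  Then for every `m ≥ 1` the linear map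
`Φ_m : QP(m) → QP(k*l*n + m)`, `Φ_m(T) = m b̄ T - q̄ ∂_y T`, is injective. -/
theorem phi_injective (k l u v n : ℕ) (hk : 0 < k) (hl : 0 < l)
    (hkl : Nat.Coprime k l) (hu : 0 < u) (hv : 0 < v)
    (huv : k * u = l * v + 1) (hul : u ≤ l) (hvk : v ≤ k) (hn : 1 ≤ n)
    (c₀ : ℂ) (hc₀ : c₀ ≠ 0) (c : Fin n → ℂ) (hc : ∀ i, c i ≠ 0)
    (hcinj : Function.Injective c)
    (lamInf : ℂ) (lam : Fin n → ℂ)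
    (hlamInf : ∀ r : ℚ, lamInf ≠ (r : ℂ))
    (hlam : ∀ i, ∀ r : ℚ, lam i ≠ (r : ℂ)) :
    ∀ m : ℕ, 1 ≤ m →
      ∀ T₁ T₂ : MvPolynomial (Fin 2) ℂ,
        T₁.IsWeightedHomogeneous ![k, l] m →
        T₂.IsWeightedHomogeneous ![k, l] m →
        (C (m : ℂ) *
            (-(C c₀) *
              ((∑ i, C (k * lam i) * X 1 ^ k *
                  ∏ j ∈ univ.erase i, (X 1 ^ k - C (c j) * X 0 ^ l)) +
                C ((v : ℂ) + k * lamInf) *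
                  ∏ i, (X 1 ^ k - C (c i) * X 0 ^ l))) * T₁ -
          (C c₀ * X 1 * ∏ i, (X 1 ^ k - C (c i) * X 0 ^ l)) * pderiv 1 T₁) =
        (C (m : ℂ) *
            (-(C c₀) *
              ((∑ i, C (k * lam i) * X 1 ^ k *
                  ∏ j ∈ univ.erase i, (X 1 ^ k - C (c j) * X 0 ^ l)) +
                C ((v : ℂ) + k * lamInf) *
                  ∏ i, (X 1 ^ k - C (c i) * X 0 ^ l))) * T₂ -
          (C c₀ * X 1 * ∏ i, (X 1 ^ k - C (c i) * X 0 ^ l)) * pderiv 1 T₂) →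
        T₁ = T₂ := by
  intro m hm T₁ T₂ _ _ h
  by_contra hne
  set P : MvPolynomial (Fin 2) ℂ := ∏ i, (X 1 ^ k - C (c i) * X 0 ^ l) with hP
  set Q : MvPolynomial (Fin 2) ℂ := ∑ i, C (k * lam i) * X 1 ^ k *
    ∏ j ∈ univ.erase i, (X 1 ^ k - C (c j) * X 0 ^ l) with hQ
  have hker : X 1 * P * pderiv 1 (T₁ - T₂) =
      -(C (m : ℂ) * (Q + C ((v : ℂ) + k * lamInf) * P)) * (T₁ - T₂) := by
    have hC : (C c₀ : MvPolynomial (Fin 2) ℂ) ≠ 0 := by simpa using hc₀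
    apply mul_left_cancel₀ hC
    rw [map_sub]
    linear_combination -h
  obtain ⟨r, W, hW⟩ := exists_nat_X_dvd_of_mul_pderiv_eq 1 (sub_ne_zero.mpr hne) hker
  have hPeval : eval ![(1 : ℂ), 0] P ≠ 0 := by
    simp [hP, map_prod, hk.ne', Finset.prod_ne_zero_iff, hc]
  have hQeval : eval ![(1 : ℂ), 0] Q = 0 := by
    simp [hQ, hk.ne']
  have hEval := congrArg (eval ![(1 : ℂ), 0]) hW
  simp only [map_sub, map_mul, map_add, map_neg, map_natCast, eval_C, eval_X, hQeval,
    Matrix.cons_val_one, Matrix.cons_val_fin_one, zero_mul, zero_add] at hEval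
  have hlin : (r : ℂ) + m * (v + k * lamInf) = 0 := by
    apply mul_right_cancel₀ hPeval
    linear_combination hEval
  have hm0 : (m : ℂ) ≠ 0 := by exact_mod_cast (by omega : m ≠ 0)
  have hk0 : (k : ℂ) ≠ 0 := by exact_mod_cast hk.ne'
  apply hlamInf (-((r : ℚ) / m + v) / k)
  push_cast
  field_simp
  linear_combination hlin
end

section
/- Let k, ℓ be coprime positive integers, u, v the unique positive integers with ku − ℓv = 1, u ≤ ℓ, v ≤ k, n ≥ 1 an integer, d = kℓn + k + ℓ. Let a, b ∈ ℂ[x,y] be (k,ℓ)-quasi-homogeneous polynomials of degrees d − k and d − ℓ respectively such that y divides a, x divides b, and kxa + ℓyb = q_d where q_d = c₀xy∏_{i=1}^n(y^k − c_ix^ℓ) for some nonzero complex numbers c₀, c₁, …, c_n with c₁, …, c_n pairwise distinct. Then there exist unique complex numbers λ₀, λ₁, …, λ_n, λ_∞ with λ₁ + ⋯ + λ_n + λ₀ + λ_∞ = −1 such that a = (q_d/x)(∑_{i=1}^n ℓλ_i c_i x^ℓ/(y^k − c_ix^ℓ) + u − ℓ(λ₀+1)) and b = −(q_d/y)(∑_{i=1}^n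 kλ_i y^k/(y^k − c_ix^ℓ) + v + kλ_∞); equivalently, a dx + b dy = −q_d(∑_{i=1}^n λ_i·d(y^k − c_ix^ℓ)/(y^k − c_ix^ℓ) + (ℓ(λ₀+1) − u)·dx/x + (kλ_∞ + v)·dy/y). -/
open MvPolynomial Finset

/-- A quasi-homogeneous polynomial of degree `k * l * n` with coprime weights `(k, l)` is a
binary form of degree `n` in `X 0 ^ l` and `X 1 ^ k`. -/
theorem isWeightedHomogeneous_eq_sum {R : Type*} [CommSemiring R] {k l : ℕ} (n : ℕ)
    (hk : 0 < k) (hl : 0 < l) (hkl : Nat.Coprime k l) {D : MvPolynomial (Fin 2) R}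
    (hD : D.IsWeightedHomogeneous ![k, l] (k * l * n)) :
    ∃ α : ℕ → R, D = ∑ s ∈ range (n + 1),
      C (α s) * X 0 ^ (l * (n - s)) * X 1 ^ (k * s) := by
  classical
  let f : ℕ → (Fin 2 →₀ ℕ) := fun s =>
    Finsupp.single 0 (l * (n - s)) + Finsupp.single 1 (k * s)
  have hf : Function.Injective f := fun s t hst => by
    have := DFunLike.congr_fun hst 1
    simp only [f, Finsupp.add_apply, Finsupp.single_apply] at this
    simpa [hk.ne'] using this
  have hsub : D.support ⊆ (range (n + 1)).image f := fun m hm => by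
    have hw := hD (mem_support_iff.mp hm)
    rw [Finsupp.weight_apply, Finsupp.sum_fintype _ _ (by simp)] at hw
    simp only [Fin.sum_univ_two, smul_eq_mul, Matrix.cons_val_zero, Matrix.cons_val_one] at hw
    obtain ⟨s, hs⟩ : k ∣ m 1 := by
      refine hkl.dvd_of_dvd_mul_right ((Nat.dvd_add_right (Dvd.intro_left (m 0) rfl)).mp ?_)
      exact hw ▸ ⟨l * n, by ring⟩
    have hm0 : m 0 + l * s = l * n := by
      apply Nat.eq_of_mul_eq_mul_left hk
      rw [hs] at hw
      linarith
    have hsn : s ≤ n := Nat.le_of_mul_le_mul_left (by omega : l * s ≤ l * n) hl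
    refine mem_image.mpr ⟨s, mem_range.mpr (by omega), ?_⟩
    ext i
    fin_cases i
    · simp [f, Nat.mul_sub]; omega
    · simp [f, hs]
  refine ⟨fun s => coeff (f s) D, ?_⟩
  conv_lhs => rw [D.as_sum]
  rw [sum_subset hsub (fun m _ hm => by simp [notMem_support_iff.mp hm]),
    sum_image hf.injOn]
  refine sum_congr rfl fun s _ => ?_
  rw [X_pow_eq_monomial, X_pow_eq_monomial, C_mul_monomial, monomial_mul]
  simp [f]

/-- A binary form of degree `n` in `X 0 ^ l`, `X 1 ^ k` is zero as soon as it vanishes at `(0, 1)`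
and on the `n` curves `X 1 ^ k = c i * X 0 ^ l`. -/
theorem isWeightedHomogeneous_eq_zero {K : Type*} [Field K] {k l n : ℕ}
    (hk : 0 < k) (hl : 0 < l) (hkl : Nat.Coprime k l) {D : MvPolynomial (Fin 2) K}
    (hD : D.IsWeightedHomogeneous ![k, l] (k * l * n)) {c w : Fin n → K}
    (hc : Function.Injective c) (hw : ∀ i, w i ^ k = c i)
    (h_inf : eval ![0, 1] D = 0) (hz : ∀ i, eval ![1, w i] D = 0) : D = 0 := by
  classical
  obtain ⟨α, rfl⟩ := isWeightedHomogeneous_eq_sum n hk hl hkl hD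
  have hn : α n = 0 := by
    rw [map_sum, sum_range_succ, sum_eq_zero] at h_inf
    · simpa using h_inf
    · intro s hs
      have : n - s ≠ 0 := by have := mem_range.mp hs; omega
      simp [this, hl.ne']
  let g : Polynomial K := ∑ s ∈ range n, Polynomial.C (α s) * Polynomial.X ^ s
  have hg : g = 0 := by
    refine Polynomial.eq_zero_of_degree_lt_of_eval_index_eq_zero (s := univ) (v := c)
      hc.injOn ?_ ?_
    · rw [card_univ, Fintype.card_fin]
      refine (Polynomial.degree_sum_le _ _).trans_lt
        ((Finset.sup_lt_iff (WithBot.bot_lt_coe n)).mpr ?_)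
      intro s hs
      exact (Polynomial.degree_C_mul_X_pow_le _ _).trans_lt (Nat.cast_lt.mpr (mem_range.mp hs))
    · intro i _
      have := hz i
      rw [map_sum, sum_range_succ] at this
      simpa [g, Polynomial.eval_finsetSum, hn, pow_mul, hw] using this
  have hα : ∀ s ∈ range (n + 1), α s = 0 := fun s hs => by
    rcases (Nat.lt_succ_iff.mp (mem_range.mp hs)).eq_or_lt with rfl | h
    · exact hn
    · have := congrArg (fun p => Polynomial.coeff p s) hg
      simpa [g, Polynomial.finsetSum_coeff, Polynomial.coeff_C_mul_X_pow, h] using this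
  exact sum_eq_zero fun s hs => by simp [hα s hs]

/-- Dividing a quasi-homogeneous polynomial by a variable lowers its degree by the weight of
the variable. -/
theorem IsWeightedHomogeneous.of_X_mul {σ R : Type*} [CommSemiring R] {w : σ → ℕ} {i : σ}
    {m : ℕ} {p : MvPolynomial σ R} (hp : (X i * p).IsWeightedHomogeneous w (m + w i)) :
    p.IsWeightedHomogeneous w m := fun d hd => by
  have := @hp (Finsupp.single i 1 + d) (by rwa [coeff_X_mul])
  simp only [map_add, Finsupp.weight_single, one_smul] at this
  omega

theorem isWeightedHomogeneous_binomial {R : Type*} [CommRing R] (k l : ℕ) (r : R) :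
    (X 1 ^ k - C r * X 0 ^ l : MvPolynomial (Fin 2) R).IsWeightedHomogeneous
      ![k, l] (k * l) := by
  have h1 := (isWeightedHomogeneous_X R ![k, l] 1).pow k
  have h0 := ((isWeightedHomogeneous_C ![k, l] r).mul
    ((isWeightedHomogeneous_X R ![k, l] 0).pow l))
  simp only [Matrix.cons_val_zero, Matrix.cons_val_one, smul_eq_mul, zero_add] at h0 h1
  rw [mul_comm l k] at h0
  exact (weightedHomogeneousSubmodule R ![k, l] (k * l)).sub_mem h1 h0

/-- Lagrange interpolation: a binary form of degree `n` in `X 0 ^ l`, `X 1 ^ k` is a combination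
of `P = ∏ i, (X 1 ^ k - C (c i) * X 0 ^ l)` and the `X 0 ^ l * P / (X 1 ^ k - C (c i) * X 0 ^ l)`,
with coefficients given by its values at `(0, 1)` and `(1, w i)`. -/
theorem eq_interpolation_iff {K : Type*} [Field K] {k l n : ℕ}
    (hk : 0 < k) (hl : 0 < l) (hkl : Nat.Coprime k l) {A : MvPolynomial (Fin 2) K}
    (hA : A.IsWeightedHomogeneous ![k, l] (k * l * n)) {c w : Fin n → K}
    (hc : Function.Injective c) (hw : ∀ i, w i ^ k = c i) (t : Fin n → K) (m : K) :
    A = (∑ i, C (t i) * X 0 ^ l * ∏ j ∈ univ.erase i, (X 1 ^ k - C (c j) * X 0 ^ l)) +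
        C m * ∏ i, (X 1 ^ k - C (c i) * X 0 ^ l) ↔
      eval ![0, 1] A = m ∧ ∀ i, eval ![1, w i] A = t i * ∏ j ∈ univ.erase i, (c i - c j) := by
  classical
  set B : MvPolynomial (Fin 2) K :=
    (∑ i, C (t i) * X 0 ^ l * ∏ j ∈ univ.erase i, (X 1 ^ k - C (c j) * X 0 ^ l)) +
      C m * ∏ i, (X 1 ^ k - C (c i) * X 0 ^ l) with hB
  have hB0 : eval ![0, 1] B = m := by simp [hB, hl.ne']
  have hB1 : ∀ i, eval ![1, w i] B = t i * ∏ j ∈ univ.erase i, (c i - c j) := fun i => by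
    simp only [hB, map_add, map_sum, map_mul, map_pow, eval_prod, map_sub, eval_C, eval_X,
      Matrix.cons_val_zero, Matrix.cons_val_one, hw, one_pow, mul_one]
    rw [prod_eq_zero (mem_univ i) (sub_self _), mul_zero, add_zero,
      sum_eq_single i _ (by simp)]
    intro j _ hj
    rw [prod_eq_zero (mem_erase.mpr ⟨hj.symm, mem_univ i⟩) (sub_self _), mul_zero]
  constructor
  · intro h
    rw [h]
    exact ⟨hB0, hB1⟩
  · rintro ⟨h0, h1⟩
    have hBh : B.IsWeightedHomogeneous ![k, l] (k * l * n) := by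
      refine IsWeightedHomogeneous.add ?_ ?_
      · refine IsWeightedHomogeneous.sum _ _ _ fun i _ => ?_
        have hX := (isWeightedHomogeneous_C ![k, l] (t i)).mul
          ((isWeightedHomogeneous_X K ![k, l] 0).pow l)
        have hP := IsWeightedHomogeneous.prod (univ.erase i)
          (fun j => (X 1 ^ k - C (c j) * X 0 ^ l : MvPolynomial (Fin 2) K)) (fun _ => k * l)
          (fun j _ => isWeightedHomogeneous_binomial k l (c j))
        convert hX.mul hP using 1
        obtain ⟨n, rfl⟩ : ∃ n', n = n' + 1 := ⟨n - 1, by have := i.pos; omega⟩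
        simp
        ring
      · have hP := (isWeightedHomogeneous_C ![k, l] m).mul (IsWeightedHomogeneous.prod univ
          (fun j => (X 1 ^ k - C (c j) * X 0 ^ l : MvPolynomial (Fin 2) K)) (fun _ => k * l)
          (fun j _ => isWeightedHomogeneous_binomial k l (c j)))
        convert hP using 1
        simp
        ring
    refine sub_eq_zero.mp (isWeightedHomogeneous_eq_zero hk hl hkl
      ((weightedHomogeneousSubmodule K ![k, l] _).sub_mem hA hBh) hc hw ?_ fun i => ?_)
    · rw [map_sub, h0, hB0, sub_self]
    · rw [map_sub, h1, hB1, sub_self]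

/-- with `k, l` coprime positive integers, `u, v` the unique
positive integers with `k*u - l*v = 1`, `u ≤ l`, `v ≤ k`, `n ≥ 1`,
`d = k*l*n + k + l`, let `a, b` be `(k,l)`-quasi-homogeneous polynomials of
degrees `d-k` and `d-l` with `y ∣ a`, `x ∣ b` and
`k x a + l y b = q_d = c₀ x y ∏ᵢ (y^k - cᵢ x^l)` (`c₀, …, c_n` nonzero,
`c₁, …, c_n` pairwise distinct).  Then there are unique complex numbers
`λ₀, (λᵢ)ᵢ, λ_∞` with `∑ᵢ λᵢ + λ₀ + λ_∞ = -1`,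
`a = (q_d/x)(∑ᵢ l λᵢ cᵢ x^l/(y^k - cᵢ x^l) + u - l(λ₀+1))` and
`b = -(q_d/y)(∑ᵢ k λᵢ y^k/(y^k - cᵢ x^l) + v + k λ_∞)`. -/
theorem logarithmic_representation (k l u v n : ℕ) (hk : 0 < k) (hl : 0 < l)
    (hkl : Nat.Coprime k l) (hu : 0 < u) (hv : 0 < v)
    (huv : k * u = l * v + 1) (hul : u ≤ l) (hvk : v ≤ k) (hn : 1 ≤ n)
    (c₀ : ℂ) (hc₀ : c₀ ≠ 0) (c : Fin n → ℂ) (hc : ∀ i, c i ≠ 0)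
    (hcinj : Function.Injective c)
    (a b : MvPolynomial (Fin 2) ℂ)
    (hah : a.IsWeightedHomogeneous ![k, l] (k * l * n + l))
    (hbh : b.IsWeightedHomogeneous ![k, l] (k * l * n + k))
    (hya : X 1 ∣ a) (hxb : X 0 ∣ b)
    (hq : C (k : ℂ) * X 0 * a + C (l : ℂ) * X 1 * b =
      C c₀ * X 0 * X 1 * ∏ i, (X 1 ^ k - C (c i) * X 0 ^ l)) :
    ∃! L : ℂ × (Fin n → ℂ) × ℂ,
      (∑ i, L.2.1 i) + L.1 + L.2.2 = -1 ∧
      a = C c₀ * X 1 *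
          ((∑ i, C (l * L.2.1 i * c i) * X 0 ^ l *
              ∏ j ∈ univ.erase i, (X 1 ^ k - C (c j) * X 0 ^ l)) +
            C ((u : ℂ) - l * (L.1 + 1)) *
              ∏ i, (X 1 ^ k - C (c i) * X 0 ^ l)) ∧
      b = -(C c₀ * X 0) *
          ((∑ i, C (k * L.2.1 i) * X 1 ^ k *
              ∏ j ∈ univ.erase i, (X 1 ^ k - C (c j) * X 0 ^ l)) +
            C ((v : ℂ) + k * L.2.2) *
              ∏ i, (X 1 ^ k - C (c i) * X 0 ^ l)) := by
  obtain ⟨A, rfl⟩ := hya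
  obtain ⟨B, rfl⟩ := hxb
  have hk' : (k : ℂ) ≠ 0 := by exact_mod_cast hk.ne'
  have hl' : (l : ℂ) ≠ 0 := by exact_mod_cast hl.ne'
  have hX0 : (X 0 : MvPolynomial (Fin 2) ℂ) ≠ 0 := X_ne_zero 0
  have hX1 : (X 1 : MvPolynomial (Fin 2) ℂ) ≠ 0 := X_ne_zero 1
  have hA : A.IsWeightedHomogeneous ![k, l] (k * l * n) := IsWeightedHomogeneous.of_X_mul hah
  choose w hw using fun i => IsAlgClosed.exists_pow_nat_eq (c i) hk
  set P : MvPolynomial (Fin 2) ℂ := ∏ i, (X 1 ^ k - C (c i) * X 0 ^ l) with hP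
  have hAB : C (k : ℂ) * A + C (l : ℂ) * B = C c₀ * P := by
    apply mul_left_cancel₀ (mul_ne_zero hX0 hX1)
    linear_combination hq
  -- The second formula follows from the first one and the relation between the residues.
  have hb : ∀ L : ℂ × (Fin n → ℂ) × ℂ, (∑ i, L.2.1 i) + L.1 + L.2.2 = -1 →
      X 1 * A = C c₀ * X 1 *
          ((∑ i, C (l * L.2.1 i * c i) * X 0 ^ l *
              ∏ j ∈ univ.erase i, (X 1 ^ k - C (c j) * X 0 ^ l)) +
            C ((u : ℂ) - l * (L.1 + 1)) * P) →
      X 0 * B = -(C c₀ * X 0) *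
          ((∑ i, C (k * L.2.1 i) * X 1 ^ k *
              ∏ j ∈ univ.erase i, (X 1 ^ k - C (c j) * X 0 ^ l)) +
            C ((v : ℂ) + k * L.2.2) * P) := by
    rintro ⟨p, r, q⟩ hsum h
    simp only at hsum h ⊢
    have hCl : (C (l : ℂ) : MvPolynomial (Fin 2) ℂ) ≠ 0 := by simpa using hl.ne'
    apply mul_left_cancel₀ (mul_ne_zero hCl hX1)
    have key : C (l : ℂ) * (∑ i, C (k * r i) * X 1 ^ k *
          ∏ j ∈ univ.erase i, (X 1 ^ k - C (c j) * X 0 ^ l)) -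
        C (k : ℂ) * (∑ i, C (l * r i * c i) * X 0 ^ l *
          ∏ j ∈ univ.erase i, (X 1 ^ k - C (c j) * X 0 ^ l)) =
        C (k * l * ∑ i, r i) * P := by
      rw [mul_sum, mul_sum, ← sum_sub_distrib, mul_sum, map_sum, sum_mul]
      refine sum_congr rfl fun i _ => ?_
      rw [hP, ← mul_prod_erase univ _ (mem_univ i)]
      simp only [map_mul]
      ring
    have hconst : (k * l * ∑ i, r i) + l * (v + k * q) - k * (u - l * (p + 1)) = (-1 : ℂ) := by
      have : (k * u : ℂ) = l * v + 1 := by exact_mod_cast huv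
      linear_combination (k * l : ℂ) * hsum - this
    have hconst' := congrArg (C : ℂ → MvPolynomial (Fin 2) ℂ) hconst
    simp only [map_add, map_sub, map_mul, map_neg, map_one] at hconst' key ⊢ h
    linear_combination X 0 * X 1 * hAB - C (k : ℂ) * X 0 * h + C c₀ * X 0 * X 1 * key
      + C c₀ * X 0 * X 1 * P * hconst'
  have hπ : ∀ i, l * c i * c₀ * ∏ j ∈ univ.erase i, (c i - c j) ≠ 0 := fun i =>
    mul_ne_zero (mul_ne_zero (mul_ne_zero hl' (hc i)) hc₀)
      (prod_ne_zero_iff.mpr fun j hj => sub_ne_zero.mpr (hcinj.ne (ne_of_mem_erase hj).symm))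
  -- The first formula amounts to prescribing the values of `A`.
  obtain ⟨p₀, r₀, ha⟩ : ∃ p₀ r₀, ∀ L : ℂ × (Fin n → ℂ) × ℂ,
      X 1 * A = C c₀ * X 1 *
          ((∑ i, C (l * L.2.1 i * c i) * X 0 ^ l *
              ∏ j ∈ univ.erase i, (X 1 ^ k - C (c j) * X 0 ^ l)) +
            C ((u : ℂ) - l * (L.1 + 1)) * P) ↔
      L.1 = p₀ ∧ L.2.1 = r₀ := by
    refine ⟨(u - eval ![0, 1] A / c₀) / l - 1, fun i => eval ![1, w i] A /
      (l * c i * c₀ * ∏ j ∈ univ.erase i, (c i - c j)), ?_⟩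
    rintro ⟨p, r, q⟩
    have h := eq_interpolation_iff hk hl hkl hA hcinj hw
      (fun i => c₀ * (l * r i * c i)) (c₀ * (u - l * (p + 1)))
    have hcomm : ∀ S : MvPolynomial (Fin 2) ℂ, C c₀ * X 1 * S = X 1 * (C c₀ * S) :=
      fun S => by ring
    rw [hcomm, mul_right_inj' hX1, mul_add, mul_sum]
    simp only [map_mul C c₀, mul_assoc (C c₀)] at h
    simp only [← mul_assoc (C c₀)] at h ⊢
    rw [h, _root_.funext_iff]
    refine and_congr ?_ (forall_congr' fun i => ?_)
    · constructor
      · intro h0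
        rw [h0]
        field_simp
        ring
      · intro h0
        rw [h0]
        field_simp
        ring
    · rw [eq_div_iff (hπ i), eq_comm]
      refine Eq.congr ?_ rfl
      ring
  have hsum : (∑ i, r₀ i) + p₀ + (-1 - (∑ i, r₀ i) - p₀) = -1 := by ring
  have h₀ := (ha ⟨p₀, r₀, -1 - (∑ i, r₀ i) - p₀⟩).mpr ⟨rfl, rfl⟩
  refine ⟨⟨p₀, r₀, -1 - (∑ i, r₀ i) - p₀⟩, ⟨hsum, h₀, hb _ hsum h₀⟩, ?_⟩
  rintro ⟨p, r, q⟩ ⟨hs, h, -⟩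
  obtain ⟨rfl, rfl⟩ := (ha _).mp h
  refine Prod.ext rfl (Prod.ext rfl ?_)
  linear_combination hs
end

section
/- Let k, ℓ be coprime positive integers and n ≥ 1 an integer. Then for every integer m with 1 ≤ m ≤ kℓn − 1, the number of pairs (i,j) of nonnegative integers with ki + ℓj = kℓn + m, i ≤ ℓn − 1 and j ≤ kn − 1 equals n − e_m, where e_m denotes the number of pairs (i,j) of nonnegative integers with ki + ℓj = m. -/
/-- If `k` and `l` are coprime, every `N ≥ k * l` is of the form `k * i + l * j` with `i < l`. -/
theorem exists_mul_add_mul_eq_of_coprime {k l N : ℕ} (hl : 0 < l) (hkl : Nat.Coprime k l)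
    (hN : k * l ≤ N) : ∃ i j, i < l ∧ k * i + l * j = N := by
  obtain ⟨z, hzk, hzl⟩ := Nat.chineseRemainder hkl 0 N
  obtain ⟨a, rfl⟩ := (Nat.modEq_zero_iff_dvd).1 hzk
  have hlt : a % l < l := Nat.mod_lt a hl
  have hmod : k * (a % l) ≡ N [MOD l] := ((Nat.mod_modEq a l).mul_left k).trans hzl
  have hle : k * (a % l) ≤ N := (Nat.mul_le_mul_left k hlt.le).trans hN
  obtain ⟨j, hj⟩ := (Nat.modEq_iff_dvd' hle).1 hmod
  exact ⟨a % l, j, hlt, by omega⟩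

/-- For coprime `k` and `l` and `N ≥ k * l * n`, the equation `k * i + l * j = N` has exactly `n`
solutions in nonnegative integers with `i < l * n`. -/
theorem ncard_mul_add_mul_eq_of_lt {k l n N : ℕ} (hl : 0 < l) (hkl : Nat.Coprime k l)
    (hn : 1 ≤ n) (hN : k * l * n ≤ N) :
    {p : ℕ × ℕ | k * p.1 + l * p.2 = N ∧ p.1 < l * n}.ncard = n := by
  obtain ⟨a, c, hal, hac⟩ := exists_mul_add_mul_eq_of_coprime hl hkl
    ((Nat.le_mul_of_pos_right (k * l) hn).trans hN)
  have himage : {p : ℕ × ℕ | k * p.1 + l * p.2 = N ∧ p.1 < l * n} =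
      (fun t => (a + l * t, c - k * t)) '' Set.Iio n := by
    ext ⟨i, j⟩
    simp only [Set.mem_ofPred_eq, Set.mem_image, Set.mem_Iio, Prod.mk.injEq]
    constructor
    · rintro ⟨hij, hi⟩
      have hmod : k * i ≡ k * a [MOD l] := by
        have h : (k * i + l * j) % l = (k * a + l * c) % l := by rw [hij, hac]
        simpa [Nat.ModEq] using h
      have hia : i % l = a := by
        have := Nat.ModEq.cancel_left_of_coprime (by simpa using hkl.symm) hmod
        rwa [Nat.ModEq, Nat.mod_eq_of_lt hal] at this
      have hdiv : a + l * (i / l) = i := hia ▸ Nat.mod_add_div i l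
      refine ⟨i / l, Nat.div_lt_of_lt_mul hi, hdiv, ?_⟩
      have hc : j + k * (i / l) = c := by
        apply Nat.eq_of_mul_eq_mul_left hl
        generalize i / l = t at hdiv
        subst hdiv
        linarith
      omega
    · rintro ⟨t, ht, rfl, rfl⟩
      have hlt : a + l * t < l * n := by nlinarith
      have hle : k * t ≤ c := by
        apply Nat.le_of_mul_le_mul_left _ hl
        have := Nat.mul_le_mul_left k hlt.le
        linarith
      refine ⟨?_, hlt⟩
      obtain ⟨d, rfl⟩ := Nat.exists_eq_add_of_le hle
      rw [Nat.add_sub_cancel_left, ← hac]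
      ring
  rw [himage, Set.ncard_image_of_injective, Set.ncard_Iio_nat]
  intro s t hst
  simpa [hl.ne'] using (Prod.mk.inj hst).1

/-- for coprime positive integers `k, l` and `n ≥ 1`, for every
`1 ≤ m ≤ k*l*n - 1`, the number of pairs `(i,j) ∈ ℕ²` with
`k*i + l*j = k*l*n + m`, `i ≤ l*n - 1` and `j ≤ k*n - 1` equals `n - e_m`. -/
theorem card_hamiltonian_coeffs (k l n : ℕ) (hk : 0 < k) (hl : 0 < l)
    (hkl : Nat.Coprime k l) (hn : 1 ≤ n) :
    ∀ m : ℕ, 1 ≤ m → m ≤ k * l * n - 1 →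
      (Nat.card {p : ℕ × ℕ //
          k * p.1 + l * p.2 = k * l * n + m ∧
            p.1 ≤ l * n - 1 ∧ p.2 ≤ k * n - 1} : ℤ) =
        n - eCount k l m := by
  intro m _ hm
  have hln : 0 < l * n := by positivity
  have hkn : 0 < k * n := by positivity
  have hkln : 0 < k * l * n := by positivity
  set X := {p : ℕ × ℕ | k * p.1 + l * p.2 = k * l * n + m ∧ p.1 < l * n}
  set S := {p : ℕ × ℕ | k * p.1 + l * p.2 = k * l * n + m ∧ p.1 ≤ l * n - 1 ∧ p.2 ≤ k * n - 1}
  set E := {p : ℕ × ℕ | k * p.1 + l * p.2 = m}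
  set f : ℕ × ℕ → ℕ × ℕ := fun p => (p.1, p.2 + k * n)
  have hf : f.Injective := by
    rintro ⟨i, j⟩ ⟨i', j'⟩ h
    simpa [f] using h
  have hX : X.ncard = n := ncard_mul_add_mul_eq_of_lt hl hkl hn (Nat.le_add_right _ _)
  have hXfin : X.Finite := Set.finite_of_ncard_pos (by omega)
  have hunion : X = S ∪ f '' E := by
    ext ⟨i, j⟩
    simp only [X, S, E, f, Set.mem_union, Set.mem_image, Set.mem_ofPred_eq, Prod.exists,
      Prod.mk.injEq]
    constructor
    · rintro ⟨hij, hi⟩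
      rcases lt_or_ge j (k * n) with hj | hj
      · exact Or.inl ⟨hij, by omega, by omega⟩
      · obtain ⟨d, rfl⟩ := Nat.exists_eq_add_of_le hj
        exact Or.inr ⟨i, d, by linarith, rfl, by omega⟩
    · rintro (⟨hij, hi, -⟩ | ⟨i, j, hij, rfl, rfl⟩)
      · exact ⟨hij, by omega⟩
      · refine ⟨by linarith, Nat.lt_of_mul_lt_mul_left (a := k) ?_⟩
        rw [← mul_assoc]
        omega
  have hdisj : Disjoint S (f '' E) := by
    rw [Set.disjoint_left]
    rintro _ ⟨-, -, hj⟩ ⟨⟨i, j⟩, -, rfl⟩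
    simp only [f] at hj
    omega
  have hcard : S.ncard + E.ncard = n := by
    rw [← Set.ncard_image_of_injective E hf, ← Set.ncard_union_eq hdisj
      (hXfin.subset (hunion ▸ Set.subset_union_left))
      (hXfin.subset (hunion ▸ Set.subset_union_right)), ← hunion, hX]
  change (S.ncard : ℤ) = n - E.ncard
  omega
end
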